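/- arXiv:2001.02992 — 6 statements merged into one kernel-verified Lean document; each statement's English description precedes it below -/
import Mathlib

section
/- Let n ≥ 1 and f : {−1,1}^{n+1} → ℝ. Let X be uniform on {−1,1}^n and Y uniform on {−1,1}, independent of X. Then ∑_{s⊆[n]} (E[f(X,Y)] − E[f(X, p_s(X))])² = 2^{−n−2} ∑_{x∈{−1,1}^n} (f(x,1) − f(x,−1))². -/
open Finset

/-- Completeness of the parity functions on the sign cube. -/
theorem sum_prod_mul_prod_units_int {ι : Type*} [Fintype ι] [DecidableEq ι] (x y : ι → ℤˣ) :
    ∑ s : Finset ι, (∏ i ∈ s, ((x i : ℤ) : ℝ)) * ∏ i ∈ s, ((y i : ℤ) : ℝ)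
      = if x = y then 2 ^ Fintype.card ι else 0 := by
  simp_rw [← prod_mul_distrib]
  rw [← powerset_univ, ← prod_one_add]
  split_ifs with hxy
  · subst hxy
    have h (i : ι) : (1 : ℝ) + ((x i : ℤ) : ℝ) * ((x i : ℤ) : ℝ) = 2 := by
      rcases Int.units_eq_one_or (x i) with hi | hi <;> norm_num [hi]
    simp [h]
  · obtain ⟨i, hi⟩ := Function.ne_iff.mp hxy
    refine prod_eq_zero (mem_univ i) ?_
    rcases Int.units_eq_one_or (x i) with hx | hx <;>
      rcases Int.units_eq_one_or (y i) with hy | hy <;> simp_all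

/-- Parseval's identity for the Fourier–Walsh basis. -/
theorem sum_sq_sum_mul_prod_units_int {ι : Type*} [Fintype ι] [DecidableEq ι]
    (g : (ι → ℤˣ) → ℝ) :
    ∑ s : Finset ι, (∑ x, g x * ∏ i ∈ s, ((x i : ℤ) : ℝ)) ^ 2
      = 2 ^ Fintype.card ι * ∑ x, g x ^ 2 := by
  simp_rw [sq, sum_mul_sum, mul_mul_mul_comm (g _)]
  rw [sum_comm, mul_sum]
  refine sum_congr rfl fun x _ => ?_
  rw [sum_comm]
  simp_rw [← mul_sum, sum_prod_mul_prod_units_int]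
  simp [mul_comm]

theorem apply_units_int_eq (h : ℤˣ → ℝ) (u : ℤˣ) :
    h u = (∑ y, h y) / 2 + (h 1 - h (-1)) * ((u : ℤ) : ℝ) / 2 := by
  rcases Int.units_eq_one_or u with rfl | rfl <;> simp <;> ring

/-- for `f : {−1,1}^{n+1} → ℝ`, with `X` uniform on `{−1,1}^n` and `Y` an
independent uniform sign (signs encoded as `ℤˣ = {±1}`),
`∑_{s⊆[n]} (E[f(X,Y)] − E[f(X,p_s(X))])² = 2^{−n−2} ∑_x (f(x,1) − f(x,−1))²`. -/
theorem parity_parseval_identity (n : ℕ) (hn : 1 ≤ n) (f : (Fin n → ℤˣ) × ℤˣ → ℝ) :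
    ∑ s : Finset (Fin n),
        ((∑ x : Fin n → ℤˣ, ∑ y : ℤˣ, f (x, y)) / 2 ^ (n + 1)
          - (∑ x : Fin n → ℤˣ, f (x, ∏ i ∈ s, x i)) / 2 ^ n) ^ 2
      = (∑ x : Fin n → ℤˣ, (f (x, 1) - f (x, -1)) ^ 2) / 2 ^ (n + 2) := by
  have key (s : Finset (Fin n)) :
      (∑ x : Fin n → ℤˣ, ∑ y : ℤˣ, f (x, y)) / 2 ^ (n + 1)
          - (∑ x : Fin n → ℤˣ, f (x, ∏ i ∈ s, x i)) / 2 ^ n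
        = -(∑ x : Fin n → ℤˣ, (f (x, 1) - f (x, -1)) * ∏ i ∈ s, ((x i : ℤ) : ℝ))
          / 2 ^ (n + 1) := by
    have h (x : Fin n → ℤˣ) := apply_units_int_eq (fun y => f (x, y)) (∏ i ∈ s, x i)
    simp only [Units.coe_prod, Int.cast_prod] at h
    simp_rw [h, sum_add_distrib, ← sum_div]
    field_simp
    ring
  simp_rw [key, div_pow, neg_sq]
  rw [← sum_div, sum_sq_sum_mul_prod_units_int, Fintype.card_fin]
  field_simp
  ring
end

section
/- Let n ≥ 1 and f : {−1,1}^{n+1} → ℝ. Let X be uniform on {−1,1}^n, Y uniform on {−1,1} independent of X, and let S be a uniformly random subset of [n]. Then Var_S(E_X[f(X, p_S(X))]) ≤ 2^{−n} · E[f²(X,Y)], where Var_S denotes the variance over the random choice of S of the quantity E_X[f(X, p_S(X))]. -/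
open Finset

/-- The mean minimizes the sum of squared deviations. -/
theorem sum_sub_mean_sq_le {ι : Type*} [Fintype ι] (a : ι → ℝ) (c N : ℝ)
    (hN : (Fintype.card ι : ℝ) = N) (hpos : 0 < N) :
    ∑ i, (a i - (1 / N) * ∑ j, a j) ^ 2 ≤ ∑ i, (a i - c) ^ 2 := by
  have key : ∀ d : ℝ, ∑ i, (a i - d) ^ 2 = ∑ i, a i ^ 2 - 2 * d * ∑ i, a i + N * d ^ 2 := by
    intro d
    simp only [sub_sq, sum_add_distrib, sum_sub_distrib, sum_const, card_univ, nsmul_eq_mul, hN,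
      mul_sum]
    congr 2
    exact sum_congr rfl fun i _ => by ring
  rw [key, key, ← sub_nonneg]
  set T := ∑ i, a i
  have : 0 ≤ N * (c - 1 / N * T) ^ 2 := by positivity
  convert this using 1
  field_simp
  ring

/-- The parity functions are orthogonal as functions of the index set. -/
theorem sum_parity_mul_parity {ι : Type*} [Fintype ι] [DecidableEq ι] (x y : ι → ℤˣ) :
    ∑ s : Finset ι, (((∏ i ∈ s, x i : ℤˣ) : ℤ) : ℝ) * (((∏ i ∈ s, y i : ℤˣ) : ℤ) : ℝ)
      = if x = y then 2 ^ Fintype.card ι else 0 := by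
  have h : ∑ s : Finset ι, (((∏ i ∈ s, x i : ℤˣ) : ℤ) : ℝ) * (((∏ i ∈ s, y i : ℤˣ) : ℤ) : ℝ)
      = ∏ i, (1 + ((x i : ℤ) : ℝ) * ((y i : ℤ) : ℝ)) := by
    rw [prod_one_add, powerset_univ]
    exact sum_congr rfl fun s _ => by push_cast; rw [prod_mul_distrib]
  rw [h]
  split_ifs with hxy
  · subst hxy
    rw [prod_congr rfl (g := fun _ => (2 : ℝ)), prod_const, card_univ]
    intro i _
    rcases Int.units_eq_one_or (x i) with hx | hx <;> norm_num [hx]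
  · obtain ⟨i, hi⟩ := Function.ne_iff.mp hxy
    refine prod_eq_zero (mem_univ i) ?_
    rcases Int.units_eq_one_or (x i) with hx | hx <;>
      rcases Int.units_eq_one_or (y i) with hy | hy <;> simp_all

/-- Parseval's identity for the parity functions. -/
theorem sum_sq_sum_mul_parity {ι : Type*} [Fintype ι] [DecidableEq ι] (h : (ι → ℤˣ) → ℝ) :
    ∑ s : Finset ι, (∑ x : ι → ℤˣ, h x * (((∏ i ∈ s, x i : ℤˣ) : ℤ) : ℝ)) ^ 2
      = 2 ^ Fintype.card ι * ∑ x, h x ^ 2 := by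
  simp only [sq (∑ x : ι → ℤˣ, _), sum_mul_sum]
  rw [sum_comm, mul_sum]
  refine sum_congr rfl fun x _ => ?_
  rw [sum_comm]
  have : ∀ y : ι → ℤˣ, ∑ s : Finset ι, h x * (((∏ i ∈ s, x i : ℤˣ) : ℤ) : ℝ) *
      (h y * (((∏ i ∈ s, y i : ℤˣ) : ℤ) : ℝ))
      = h x * h y * if x = y then 2 ^ Fintype.card ι else 0 := by
    intro y
    rw [← sum_parity_mul_parity, mul_sum]
    exact sum_congr rfl fun s _ => by ring
  simp only [this, mul_ite, mul_zero, sum_ite_eq, mem_univ, if_true]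
  ring

/-- for `f : {−1,1}^{n+1} → ℝ`, with `X` uniform on `{−1,1}^n`, `Y` an
independent uniform sign and `S` a uniformly random subset of `[n]`,
`Var_S(E_X[f(X,p_S(X))]) ≤ 2^{−n} E[f²(X,Y)]` (signs encoded as `ℤˣ = {±1}`). -/
theorem parity_correlation_variance_bound (n : ℕ) (hn : 1 ≤ n)
    (f : (Fin n → ℤˣ) × ℤˣ → ℝ) :
    (1 / 2 ^ n) * ∑ s : Finset (Fin n),
        ((∑ x : Fin n → ℤˣ, f (x, ∏ i ∈ s, x i)) / 2 ^ n
          - (1 / 2 ^ n) * ∑ s' : Finset (Fin n),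
              (∑ x : Fin n → ℤˣ, f (x, ∏ i ∈ s', x i)) / 2 ^ n) ^ 2
      ≤ (1 / 2 ^ n) * ((∑ x : Fin n → ℤˣ, ∑ y : ℤˣ, f (x, y) ^ 2) / 2 ^ (n + 1)) := by
  set g : (Fin n → ℤˣ) → ℝ := fun x => (f (x, 1) + f (x, -1)) / 2 with hg
  set h : (Fin n → ℤˣ) → ℝ := fun x => (f (x, 1) - f (x, -1)) / 2 with hh
  have hf : ∀ x u, f (x, u) = g x + h x * ((u : ℤ) : ℝ) := by
    intro x u
    rcases Int.units_eq_one_or u with rfl | rfl <;> simp [hg, hh] <;> ring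
  have hN : (0 : ℝ) < 2 ^ n := by positivity
  refine mul_le_mul_of_nonneg_left ?_ (by positivity)
  refine (sum_sub_mean_sq_le _ ((∑ x, g x) / 2 ^ n) (2 ^ n) (by simp) hN).trans ?_
  have hdev : ∀ s : Finset (Fin n),
      ((∑ x : Fin n → ℤˣ, f (x, ∏ i ∈ s, x i)) / 2 ^ n - (∑ x, g x) / 2 ^ n) ^ 2
        = (∑ x : Fin n → ℤˣ, h x * (((∏ i ∈ s, x i : ℤˣ) : ℤ) : ℝ)) ^ 2 / (2 ^ n) ^ 2 := by
    intro s
    simp only [hf, sum_add_distrib]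
    ring
  have hsq : ∑ x : Fin n → ℤˣ, ∑ y : ℤˣ, f (x, y) ^ 2 = 2 * ∑ x, g x ^ 2 + 2 * ∑ x, h x ^ 2 := by
    rw [mul_sum, mul_sum, ← sum_add_distrib]
    refine sum_congr rfl fun x _ => ?_
    have huniv : (univ : Finset ℤˣ) = {1, -1} := rfl
    rw [huniv, sum_pair (by decide), hf, hf]
    push_cast
    ring
  rw [sum_congr rfl fun s _ => hdev s, ← sum_div, sum_sq_sum_mul_parity, hsq, Fintype.card_fin,
    pow_succ 2 n, div_le_div_iff₀ (by positivity) (by positivity)]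
  have hgs : 0 ≤ ∑ x, g x ^ 2 := sum_nonneg fun x _ => sq_nonneg _
  have : 0 ≤ 2 * (∑ x, g x ^ 2) * (2 ^ n) ^ 2 := by positivity
  linarith
end

section
/- Let 𝒳 be a nonempty finite set, P_𝒳 a probability measure on 𝒳, and P_ℱ a probability measure on the set of functions 𝒳 → {−1,1}. Let (X,F) ∼ P_𝒳 × P_ℱ, Y = F(X), and let (X̃,Ỹ) ∼ P_𝒳 × Unif{−1,1} be independent of (X,F). Let g : 𝒳 × {−1,1} → {0,1}, W = g(X,Y), and W̃ = g(X̃,Ỹ). Then Var(E[W | F]) ≤ E_F[(P(g(X,F(X))=1) − P(W̃=1))²] ≤ min_{i∈{0,1}} P(W̃ = i) · √(CP(P_𝒳, P_ℱ)). -/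
open Finset

/-- Cross-predictability of a distribution `pF` on sign-valued functions with respect to an
input distribution `pX` on a finite set `𝒳`. Signs are encoded as `ℤˣ = {±1}`. -/
noncomputable def cp {𝒳 : Type*} [Fintype 𝒳] [DecidableEq 𝒳] (pX : 𝒳 → ℝ)
    (pF : (𝒳 → ℤˣ) → ℝ) : ℝ :=
  ∑ F : 𝒳 → ℤˣ, ∑ F' : 𝒳 → ℤˣ, pF F * pF F' *
    (∑ x : 𝒳, pX x * (((F x : ℤ) : ℝ) * ((F' x : ℤ) : ℝ))) ^ 2

theorem sq_weighted_sum_mul_le {ι : Type*} (s : Finset ι) (w f g : ι → ℝ)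
    (hw : ∀ i ∈ s, 0 ≤ w i) :
    (∑ i ∈ s, w i * (f i * g i)) ^ 2 ≤ (∑ i ∈ s, w i * f i ^ 2) * ∑ i ∈ s, w i * g i ^ 2 :=
  Finset.sum_sq_le_sum_mul_sum_of_sq_le_mul s
    (fun i hi => mul_nonneg (hw i hi) (sq_nonneg _))
    (fun i hi => mul_nonneg (hw i hi) (sq_nonneg _)) (fun i _ => le_of_eq (by ring))

/-- The mean squared correlation of `h` with a random function `φ i` is at most `‖h‖²` times the
root of the mean squared correlation of two independent copies of `φ i`. -/
theorem weighted_sum_sq_inner_le {ι α : Type*} [Fintype ι] [Fintype α]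
    (p : ι → ℝ) (hp : ∀ i, 0 ≤ p i) (w : α → ℝ) (hw : ∀ x, 0 ≤ w x)
    (φ : ι → α → ℝ) (h : α → ℝ) :
    ∑ i, p i * (∑ x, w x * (h x * φ i x)) ^ 2 ≤
      (∑ x, w x * h x ^ 2) *
        Real.sqrt (∑ i, ∑ j, p i * p j * (∑ x, w x * (φ i x * φ j x)) ^ 2) := by
  set a : ι → ℝ := fun i => ∑ x, w x * (h x * φ i x) with ha
  set S := ∑ i, p i * a i ^ 2 with hS
  set C := ∑ i, ∑ j, p i * p j * (∑ x, w x * (φ i x * φ j x)) ^ 2 with hC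
  set v : α → ℝ := fun x => ∑ i, p i * a i * φ i x with hv
  have hS0 : 0 ≤ S := sum_nonneg fun i _ => mul_nonneg (hp i) (sq_nonneg _)
  have hH0 : 0 ≤ ∑ x, w x * h x ^ 2 := sum_nonneg fun x _ => mul_nonneg (hw x) (sq_nonneg _)
  have hSv : S = ∑ x, w x * (h x * v x) := by
    simp only [hS, hv, mul_sum]
    rw [sum_comm]
    refine sum_congr rfl fun i _ => ?_
    rw [sq, ← mul_assoc]
    nth_rewrite 2 [ha]
    rw [mul_sum]
    exact sum_congr rfl fun x _ => by ring
  have hT : ∑ x, w x * v x ^ 2 =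
      ∑ q : ι × ι, p q.1 * p q.2 * ((a q.1 * a q.2) * ∑ x, w x * (φ q.1 x * φ q.2 x)) := by
    rw [Fintype.sum_prod_type]
    have expand (x : α) : w x * v x ^ 2 =
        ∑ i, ∑ j, w x * ((p i * a i * φ i x) * (p j * a j * φ j x)) := by
      rw [sq, hv, sum_mul_sum]
      simp only [mul_sum]
    simp only [expand, mul_sum]
    rw [sum_comm]
    refine sum_congr rfl fun i _ => ?_
    rw [sum_comm]
    exact sum_congr rfl fun j _ => sum_congr rfl fun x _ => by ring
  have hSS : ∑ q : ι × ι, p q.1 * p q.2 * (a q.1 * a q.2) ^ 2 = S ^ 2 := by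
    rw [Fintype.sum_prod_type, hS, sq, sum_mul_sum]
    exact sum_congr rfl fun i _ => sum_congr rfl fun j _ => by ring
  have hTC : (∑ x, w x * v x ^ 2) ^ 2 ≤ S ^ 2 * C := by
    have key := sq_weighted_sum_mul_le univ (fun q : ι × ι => p q.1 * p q.2)
      (fun q => a q.1 * a q.2) (fun q => ∑ x, w x * (φ q.1 x * φ q.2 x))
      (fun q _ => mul_nonneg (hp _) (hp _))
    rw [← hT, hSS, Fintype.sum_prod_type] at key
    exact key
  have hTle : ∑ x, w x * v x ^ 2 ≤ S * Real.sqrt C := by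
    rw [← Real.sqrt_sq hS0, ← Real.sqrt_mul (sq_nonneg S)]
    exact Real.le_sqrt_of_sq_le hTC
  have hS2 : S * S ≤ (∑ x, w x * h x ^ 2) * Real.sqrt C * S := by
    have key := sq_weighted_sum_mul_le univ w h v fun x _ => hw x
    rw [← hSv] at key
    nlinarith [mul_le_mul_of_nonneg_left hTle hH0]
  rcases hS0.eq_or_lt with h0 | h0
  · rw [← h0]
    positivity
  · exact le_of_mul_le_mul_right hS2 h0

/-- The mean minimises the expected squared deviation. -/
theorem sum_mul_sub_mean_sq_le {ι : Type*} [Fintype ι] (p : ι → ℝ) (hp : ∑ i, p i = 1)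
    (f : ι → ℝ) (c : ℝ) :
    ∑ i, p i * (f i - ∑ j, p j * f j) ^ 2 ≤ ∑ i, p i * (f i - c) ^ 2 := by
  have expand (d : ℝ) : ∑ i, p i * (f i - d) ^ 2 =
      ∑ i, p i * f i ^ 2 - 2 * d * ∑ i, p i * f i + d ^ 2 := by
    rw [← mul_one (d ^ 2), ← hp, mul_sum, mul_sum, ← sum_sub_distrib, ← sum_add_distrib]
    exact sum_congr rfl fun i _ => by ring
  rw [expand, expand]
  nlinarith [sq_nonneg (∑ j, p j * f j - c)]

/-- for `(X,F) ∼ P_𝒳 × P_ℱ`, `Y = F(X)`, `(X̃,Ỹ) ∼ P_𝒳 × Unif{±1}` independent,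
`g : 𝒳 × {±1} → {0,1}`, `W = g(X,Y)`, `W̃ = g(X̃,Ỹ)`:
`Var(E[W|F]) ≤ E_F[(P(g(X,F(X))=1) − P(W̃=1))²] ≤ min_i P(W̃=i) · √CP`.
Here `qF F = P(W=1|F)`, `qbar = P(W=1)`, `qtil1 = P(W̃=1)`, `qtil0 = P(W̃=0)`. -/
theorem one_bit_information_bound {𝒳 : Type*} [Fintype 𝒳] [DecidableEq 𝒳] [Nonempty 𝒳]
    (pX : 𝒳 → ℝ) (hpX0 : ∀ x, 0 ≤ pX x) (hpX1 : ∑ x : 𝒳, pX x = 1)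
    (pF : (𝒳 → ℤˣ) → ℝ) (hpF0 : ∀ F, 0 ≤ pF F) (hpF1 : ∑ F : 𝒳 → ℤˣ, pF F = 1)
    (g : 𝒳 → ℤˣ → Bool)
    (qF : (𝒳 → ℤˣ) → ℝ)
    (hqF : ∀ F, qF F = ∑ x : 𝒳, pX x * (if g x (F x) then (1 : ℝ) else 0))
    (qbar : ℝ) (hqbar : qbar = ∑ F : 𝒳 → ℤˣ, pF F * qF F)
    (qtil1 : ℝ) (hqtil1 : qtil1 = ∑ x : 𝒳, pX x *
      (((if g x 1 then (1 : ℝ) else 0) + (if g x (-1) then (1 : ℝ) else 0)) / 2))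
    (qtil0 : ℝ) (hqtil0 : qtil0 = ∑ x : 𝒳, pX x *
      (((if g x 1 then (0 : ℝ) else 1) + (if g x (-1) then (0 : ℝ) else 1)) / 2)) :
    (∑ F : 𝒳 → ℤˣ, pF F * (qF F - qbar) ^ 2
        ≤ ∑ F : 𝒳 → ℤˣ, pF F * (qF F - qtil1) ^ 2) ∧
    (∑ F : 𝒳 → ℤˣ, pF F * (qF F - qtil1) ^ 2
        ≤ min qtil0 qtil1 * Real.sqrt (cp pX pF)) := by
  subst hqbar
  refine ⟨sum_mul_sub_mean_sq_le pF hpF1 qF qtil1, ?_⟩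
  set h : 𝒳 → ℝ := fun x =>
    ((if g x 1 then (1 : ℝ) else 0) - (if g x (-1) then (1 : ℝ) else 0)) / 2 with hh
  have hdiff (F : 𝒳 → ℤˣ) : qF F - qtil1 = ∑ x, pX x * (h x * ((F x : ℤ) : ℝ)) := by
    rw [hqF, hqtil1, ← sum_sub_distrib]
    refine sum_congr rfl fun x _ => ?_
    rcases Int.units_eq_one_or (F x) with hF | hF <;> simp only [hh, hF] <;> push_cast <;> ring
  have hmin : ∑ x, pX x * h x ^ 2 ≤ min qtil0 qtil1 := by
    rw [hqtil0, hqtil1]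
    refine le_min ?_ ?_ <;>
    · refine sum_le_sum fun x _ => mul_le_mul_of_nonneg_left ?_ (hpX0 x)
      simp only [hh]
      split_ifs <;> norm_num
  simp only [hdiff]
  exact (weighted_sum_sq_inner_le pF hpF0 pX hpX0 (fun F x => ((F x : ℤ) : ℝ)) h).trans
    (mul_le_mul_of_nonneg_right hmin (Real.sqrt_nonneg _))
end

section
/- Let n, m ≥ 1 and g : {−1,1}^n × {−1,1} → [m]. Let X be uniform on {−1,1}^n, and let (X̃,Ỹ) be uniform on {−1,1}^n × {−1,1}, independent of X. For s ⊆ [n] let W_s = g(X, p_s(X)) and let W̃ = g(X̃,Ỹ). Then ∑_{i∈[m]} ∑_{s⊆[n]} (P(W_s = i) − P(W̃ = i))² ≤ 2^{n/2}. -/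
open Finset

/-- The parity function `x ↦ ∏ j ∈ s, x j`, with real values. -/
noncomputable def realParity {ι : Type*} (s : Finset ι) (x : ι → ℤˣ) : ℝ :=
  ((∏ j ∈ s, x j : ℤˣ) : ℤ)

/-- Orthogonality of the point evaluations of parities. -/
lemma sum_realParity_mul_realParity {ι : Type*} [Fintype ι] [DecidableEq ι] (x y : ι → ℤˣ) :
    ∑ s : Finset ι, realParity s x * realParity s y =
      if x = y then 2 ^ Fintype.card ι else 0 := by
  have expand : ∑ s : Finset ι, realParity s x * realParity s y =
      ∏ j, (1 + ((x j * y j : ℤˣ) : ℤ) : ℝ) := by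
    rw [Finset.prod_one_add, Finset.powerset_univ]
    refine Finset.sum_congr rfl fun s _ => ?_
    simp [realParity, Finset.prod_mul_distrib]
  rw [expand]
  split_ifs with h
  · subst h
    simp [one_add_one_eq_two]
  · obtain ⟨j, hj⟩ := Function.ne_iff.mp h
    refine Finset.prod_eq_zero (Finset.mem_univ j) ?_
    rcases Int.units_eq_one_or (x j) with hx | hx <;>
      rcases Int.units_eq_one_or (y j) with hy | hy <;> simp_all

/-- Parseval's identity for parities. -/
lemma sum_sq_sum_mul_realParity {ι : Type*} [Fintype ι] [DecidableEq ι] (b : (ι → ℤˣ) → ℝ) :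
    ∑ s : Finset ι, (∑ x, b x * realParity s x) ^ 2 =
      2 ^ Fintype.card ι * ∑ x, b x ^ 2 := by
  have swap : ∑ s : Finset ι, (∑ x, b x * realParity s x) ^ 2 =
      ∑ x, ∑ y, b x * b y * ∑ s : Finset ι, realParity s x * realParity s y := by
    simp_rw [sq, Finset.sum_mul_sum, Finset.mul_sum]
    rw [Finset.sum_comm]
    refine Finset.sum_congr rfl fun x _ => ?_
    rw [Finset.sum_comm]
    refine Finset.sum_congr rfl fun y _ => Finset.sum_congr rfl fun s _ => ?_
    ring
  simp_rw [swap, sum_realParity_mul_realParity, mul_ite, mul_zero, Finset.sum_ite_eq,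
    Finset.mem_univ, if_true, Finset.mul_sum]
  exact Finset.sum_congr rfl fun x _ => by ring

/-- The average of `F x (∏ j ∈ s, x j)` minus that of `F x y` is a Fourier coefficient. -/
lemma mean_parity_sub_mean {n : ℕ} (F : (Fin n → ℤˣ) → ℤˣ → ℝ) (s : Finset (Fin n)) :
    (∑ x, (1 / 2 ^ n : ℝ) * F x (∏ j ∈ s, x j)) - ∑ x, ∑ y, (1 / 2 ^ (n + 1) : ℝ) * F x y =
      1 / 2 ^ n * ∑ x, (F x 1 - F x (-1)) / 2 * realParity s x := by
  rw [← Finset.sum_sub_distrib, Finset.mul_sum]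
  refine Finset.sum_congr rfl fun x _ => ?_
  rw [UnitsInt.univ, Finset.sum_pair (by decide), realParity, pow_succ]
  rcases Int.units_eq_one_or (∏ j ∈ s, x j) with h | h <;> rw [h] <;> push_cast <;>
    field_simp <;> ring

lemma sum_sq_half_indicator_sub_le {α : Type*} [Fintype α] [DecidableEq α] (a b : α) :
    ∑ i, (((if a = i then 1 else 0) - (if b = i then 1 else 0) : ℝ) / 2) ^ 2 ≤ 1 / 2 := by
  calc ∑ i, (((if a = i then 1 else 0) - (if b = i then 1 else 0) : ℝ) / 2) ^ 2
      ≤ ∑ i, ((if a = i then 1 / 4 else 0) + (if b = i then 1 / 4 else 0) : ℝ) := by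
        refine Finset.sum_le_sum fun i _ => ?_
        split_ifs <;> norm_num
    _ = 1 / 2 := by
        rw [Finset.sum_add_distrib]
        simp only [Finset.sum_ite_eq, Finset.mem_univ, if_true]
        norm_num

/-- for `g : {−1,1}^n × {−1,1} → [m]`, with `X` uniform on `{−1,1}^n` and
`(X̃,Ỹ)` uniform on `{−1,1}^{n+1}` independent of `X`, `W_s = g(X, p_s(X))`, `W̃ = g(X̃,Ỹ)`:
`∑_{i∈[m]} ∑_{s⊆[n]} (P(W_s=i) − P(W̃=i))² ≤ 2^{n/2}` (signs encoded as `ℤˣ = {±1}`). -/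
theorem parity_output_distribution_bound (n m : ℕ) (hn : 1 ≤ n) (hm : 1 ≤ m)
    (g : (Fin n → ℤˣ) × ℤˣ → Fin m) :
    ∑ i : Fin m, ∑ s : Finset (Fin n),
        ((∑ x : Fin n → ℤˣ, (1 / 2 ^ n : ℝ) * (if g (x, ∏ j ∈ s, x j) = i then 1 else 0))
          - ∑ x : Fin n → ℤˣ, ∑ y : ℤˣ,
              (1 / 2 ^ (n + 1) : ℝ) * (if g (x, y) = i then 1 else 0)) ^ 2
      ≤ Real.sqrt (2 ^ n) := by
  calc _ = ∑ i : Fin m, (1 / 2 ^ n : ℝ) * ∑ x : Fin n → ℤˣ,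
        (((if g (x, 1) = i then 1 else 0) - (if g (x, -1) = i then 1 else 0) : ℝ) / 2) ^ 2 := by
        refine Finset.sum_congr rfl fun i _ => ?_
        simp_rw [mean_parity_sub_mean (fun x y => if g (x, y) = i then (1 : ℝ) else 0), mul_pow,
          ← Finset.mul_sum, sum_sq_sum_mul_realParity, Fintype.card_fin]
        field_simp
    _ = (1 / 2 ^ n : ℝ) * ∑ x : Fin n → ℤˣ, ∑ i : Fin m,
        (((if g (x, 1) = i then 1 else 0) - (if g (x, -1) = i then 1 else 0) : ℝ) / 2) ^ 2 := by
        rw [← Finset.mul_sum, Finset.sum_comm]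
    _ ≤ (1 / 2 ^ n : ℝ) * ∑ _x : Fin n → ℤˣ, (1 / 2 : ℝ) := by
        gcongr
        exact sum_sq_half_indicator_sub_le _ _
    _ = 1 / 2 := by simp
    _ ≤ 1 := by norm_num
    _ ≤ Real.sqrt (2 ^ n) := Real.one_le_sqrt.mpr (one_le_pow₀ one_le_two)
end

section
/- There exists a universal constant C > 0 such that the following holds. Let n ≥ 1, let 𝒲 be a nonempty finite set, let A be a sequential learning algorithm on ({−1,1}^{n+1}, 𝒲), and let P_ℱ be a probability measure on the set of functions {−1,1}^n → {−1,1}. Let cp = CP(Unif({−1,1}^n), P_ℱ) and q = cp^{1/24}. Let ⋆ be the uniform distribution on {−1,1}^{n+1}, and for a function f let ρ_f be the law of (X, f(X)) with X uniform on {−1,1}^n. Let the random distribution P_𝒵 be chosen as follows: with probability 1/2, P_𝒵 = ⋆; otherwise draw F ∼ P_ℱ and set P_𝒵 = ρ_F. Suppose |𝒲| ≤ 1/q and m is a positive integer with m < 1/q, and let ((Z_1,W_1),…,(Z_m,W_m)) be an m-trace of A for P_𝒵. Then ∑_{w^m ∈ 𝒲^m} | P(W_1=w_1,…,W_m=w_m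 | P_𝒵 = ⋆) − P(W_1=w_1,…,W_m=w_m | P_𝒵 ≠ ⋆) | ≤ C·q. -/
open Finset

/-- The probability that an `m`-trace of the sequential learning algorithm `A` (which maps a
sample in `{−1,1}^{n+1}` and the list of previously recorded values to a new value in `𝒲`)
equals `w`, when the samples are i.i.d. from the distribution with weights `q`:
`P(W^m = w^m) = ∏_i P_{Z∼q}(A(Z, (w_1,…,w_{i−1})) = w_i)`. -/
noncomputable def traceProb {n : ℕ} {𝒲 : Type*} [Fintype 𝒲] [DecidableEq 𝒲]
    (A : ((Fin n → ℤˣ) × ℤˣ) → List 𝒲 → 𝒲)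
    (q : (Fin n → ℤˣ) × ℤˣ → ℝ) (m : ℕ) (w : Fin m → 𝒲) : ℝ :=
  ∏ i : Fin m, ∑ z : (Fin n → ℤˣ) × ℤˣ, q z *
    (if A z (List.ofFn fun j : Fin i.1 => w (Fin.castLE i.isLt.le j)) = w i then 1 else 0)

/-- The probability of `w` under the sequential process with transition weights `k`. -/
noncomputable def seqProb {𝒲 : Type*} (k : List 𝒲 → 𝒲 → ℝ) (m : ℕ) (w : Fin m → 𝒲) : ℝ :=
  ∏ i : Fin m, k (List.ofFn fun j : Fin i.1 => w (Fin.castLE i.isLt.le j)) (w i)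

theorem seqProb_nonneg {𝒲 : Type*} {k : List 𝒲 → 𝒲 → ℝ} (hk : ∀ l a, 0 ≤ k l a)
    (m : ℕ) (w : Fin m → 𝒲) : 0 ≤ seqProb k m w :=
  prod_nonneg fun _ _ => hk _ _

theorem seqProb_snoc {𝒲 : Type*} (k : List 𝒲 → 𝒲 → ℝ) (m : ℕ) (w : Fin m → 𝒲) (a : 𝒲) :
    seqProb k (m + 1) (Fin.snoc (α := fun _ => 𝒲) w a) = seqProb k m w * k (List.ofFn w) a := by
  have hcast (i : ℕ) (hi : i ≤ m) (hi' : i ≤ m + 1) (j : Fin i) :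
      Fin.snoc (α := fun _ => 𝒲) w a (Fin.castLE hi' j) = w (Fin.castLE hi j) :=
    Fin.snoc_castSucc (α := fun _ => 𝒲) a w (Fin.castLE hi j)
  unfold seqProb
  rw [Fin.prod_univ_castSucc]
  congr 1
  · refine prod_congr rfl fun i _ => ?_
    rw [Fin.snoc_castSucc]
    congr 2
    exact funext fun j => hcast i i.isLt.le _ j
  · rw [Fin.snoc_last]
    congr 2
    exact funext fun j => hcast m le_rfl _ j

theorem sum_snoc {𝒲 : Type*} [Fintype 𝒲] (m : ℕ) (f : (Fin (m + 1) → 𝒲) → ℝ) :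
    ∑ w, f w = ∑ w : Fin m → 𝒲, ∑ a, f (Fin.snoc (α := fun _ => 𝒲) w a) := by
  rw [← (Fin.snocEquiv fun _ => 𝒲).sum_comp, Fintype.sum_prod_type, sum_comm]
  rfl

theorem sum_seqProb {𝒲 : Type*} [Fintype 𝒲] {k : List 𝒲 → 𝒲 → ℝ}
    (hk : ∀ l, ∑ a, k l a = 1) (m : ℕ) : ∑ w, seqProb k m w = 1 := by
  induction m with
  | zero => simp [seqProb]
  | succ m ih =>
    rw [sum_snoc]
    simp_rw [seqProb_snoc, ← mul_sum, hk, mul_one]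
    exact ih

/-- Hybrid argument: if the transitions of `k` and of `k' F` differ by at most `δ` on average
over `F`, then the laws of the length-`m` processes differ by at most `m * δ` on average. -/
theorem sum_abs_seqProb_sub_le {𝒲 ι : Type*} [Fintype 𝒲] [Fintype ι] {p : ι → ℝ}
    (hp : ∀ F, 0 ≤ p F) {k : List 𝒲 → 𝒲 → ℝ} {k' : ι → List 𝒲 → 𝒲 → ℝ}
    (hk : ∀ l a, 0 ≤ k l a) (hk1 : ∀ l, ∑ a, k l a = 1)
    (hk' : ∀ F l a, 0 ≤ k' F l a) (hk1' : ∀ F l, ∑ a, k' F l a = 1) {δ : ℝ}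
    (hδ : ∀ l, ∑ F, p F * ∑ a, |k l a - k' F l a| ≤ δ) (m : ℕ) :
    ∑ F, p F * ∑ w, |seqProb k m w - seqProb (k' F) m w| ≤ m * δ := by
  induction m with
  | zero => simp [seqProb]
  | succ m ih =>
    have step (F : ι) : ∑ w, |seqProb k (m + 1) w - seqProb (k' F) (m + 1) w| ≤
        ∑ w, |seqProb k m w - seqProb (k' F) m w| +
          ∑ w, seqProb k m w * ∑ a, |k (List.ofFn w) a - k' F (List.ofFn w) a| := by
      rw [sum_snoc, ← sum_add_distrib]
      refine sum_le_sum fun w _ => ?_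
      have hsum : |seqProb k m w - seqProb (k' F) m w| =
          ∑ a, |seqProb k m w - seqProb (k' F) m w| * k' F (List.ofFn w) a := by
        rw [← mul_sum, hk1', mul_one]
      rw [hsum, mul_sum, ← sum_add_distrib]
      refine sum_le_sum fun a _ => ?_
      rw [seqProb_snoc, seqProb_snoc]
      calc _ = |(seqProb k m w - seqProb (k' F) m w) * k' F (List.ofFn w) a +
            seqProb k m w * (k (List.ofFn w) a - k' F (List.ofFn w) a)| := by congr 1; ring
        _ ≤ _ := abs_add_le _ _
        _ = _ := by
          rw [abs_mul, abs_mul, abs_of_nonneg (hk' _ _ _), abs_of_nonneg (seqProb_nonneg hk m w)]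
    calc _ ≤ ∑ F, p F * (∑ w, |seqProb k m w - seqProb (k' F) m w| +
          ∑ w, seqProb k m w * ∑ a, |k (List.ofFn w) a - k' F (List.ofFn w) a|) :=
          sum_le_sum fun F _ => mul_le_mul_of_nonneg_left (step F) (hp F)
      _ = ∑ F, p F * ∑ w, |seqProb k m w - seqProb (k' F) m w| +
          ∑ w, seqProb k m w * ∑ F, p F * ∑ a, |k (List.ofFn w) a - k' F (List.ofFn w) a| := by
        simp_rw [mul_add, sum_add_distrib]
        congr 1
        simp_rw [mul_sum (s := (univ : Finset (Fin m → 𝒲)))]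
        rw [sum_comm]
        refine sum_congr rfl fun w _ => ?_
        rw [mul_sum]
        exact sum_congr rfl fun F _ => mul_left_comm _ _ _
      _ ≤ m * δ + ∑ w, seqProb k m w * δ :=
        add_le_add ih (sum_le_sum fun w _ =>
          mul_le_mul_of_nonneg_left (hδ _) (seqProb_nonneg hk m w))
      _ = _ := by
        rw [← sum_mul, sum_seqProb hk1]
        push_cast
        ring

theorem sq_weighted_sum_le {ι : Type*} [Fintype ι] {p : ι → ℝ} (hp : ∀ i, 0 ≤ p i)
    (hp1 : ∑ i, p i = 1) (f : ι → ℝ) : (∑ i, p i * f i) ^ 2 ≤ ∑ i, p i * f i ^ 2 :=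
  Real.pow_arith_mean_le_arith_mean_pow_of_even univ p f (fun i _ => hp i) hp1 even_two

theorem cp_eq_sum_sq {𝒳 : Type*} [Fintype 𝒳] [DecidableEq 𝒳] (pX : 𝒳 → ℝ)
    (pF : (𝒳 → ℤˣ) → ℝ) :
    cp pX pF = ∑ x, ∑ y, pX x * pX y *
      (∑ F, pF F * (((F x : ℤ) : ℝ) * ((F y : ℤ) : ℝ))) ^ 2 := by
  unfold cp
  simp_rw [sq, sum_mul_sum, mul_sum]
  rw [sum_congr rfl fun F _ => sum_comm, sum_comm]
  rw [sum_congr rfl fun x _ => sum_congr rfl fun F _ => sum_comm]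
  rw [sum_congr rfl fun x _ => sum_comm]
  refine sum_congr rfl fun x _ => sum_congr rfl fun y _ => sum_congr rfl fun F _ =>
    sum_congr rfl fun G _ => ?_
  ring

theorem cp_nonneg {𝒳 : Type*} [Fintype 𝒳] [DecidableEq 𝒳] (pX : 𝒳 → ℝ)
    {pF : (𝒳 → ℤˣ) → ℝ} (hF : ∀ F, 0 ≤ pF F) : 0 ≤ cp pX pF :=
  sum_nonneg fun F _ => sum_nonneg fun G _ =>
    mul_nonneg (mul_nonneg (hF F) (hF G)) (sq_nonneg _)

/-- A bounded query `h` has correlation at most `cp ^ (1/4)` on average with a random `F`. -/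
theorem sum_abs_correlation_pow_four_le {𝒳 : Type*} [Fintype 𝒳] [DecidableEq 𝒳] {pX : 𝒳 → ℝ}
    {pF : (𝒳 → ℤˣ) → ℝ} (hX : ∀ x, 0 ≤ pX x) (hX1 : ∑ x, pX x = 1)
    (hF : ∀ F, 0 ≤ pF F) (hF1 : ∑ F, pF F = 1) {h : 𝒳 → ℝ} (hh : ∀ x, |h x| ≤ 1) :
    (∑ F, pF F * |∑ x, pX x * (h x * ((F x : ℤ) : ℝ))|) ^ 4 ≤ cp pX pF := by
  have hsq (x : 𝒳) : h x ^ 2 ≤ 1 := (sq_le_one_iff_abs_le_one _).2 (hh x)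
  set V := ∑ F, pF F * (∑ x, pX x * (h x * ((F x : ℤ) : ℝ))) ^ 2 with hV
  have h1 : (∑ F, pF F * |∑ x, pX x * (h x * ((F x : ℤ) : ℝ))|) ^ 2 ≤ V := by
    have := sq_weighted_sum_le hF hF1
      fun F : 𝒳 → ℤˣ => |∑ x, pX x * (h x * ((F x : ℤ) : ℝ))|
    simpa only [sq_abs] using this
  have hVeq : V = ∑ z : 𝒳 × 𝒳, pX z.1 * pX z.2 * ((h z.1 * h z.2) *
      ∑ F, pF F * (((F z.1 : ℤ) : ℝ) * ((F z.2 : ℤ) : ℝ))) := by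
    rw [hV, Fintype.sum_prod_type]
    simp_rw [sq, sum_mul_sum, mul_sum]
    rw [sum_comm, sum_congr rfl fun x _ => sum_comm]
    refine sum_congr rfl fun x _ => sum_congr rfl fun y _ => sum_congr rfl fun F _ => ?_
    ring
  have h2 : V ^ 2 ≤ cp pX pF := by
    have hw : ∀ z : 𝒳 × 𝒳, 0 ≤ pX z.1 * pX z.2 := fun z => mul_nonneg (hX _) (hX _)
    have hw1 : ∑ z : 𝒳 × 𝒳, pX z.1 * pX z.2 = 1 := by
      rw [Fintype.sum_prod_type, ← sum_mul_sum, hX1, one_mul]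
    rw [hVeq, cp_eq_sum_sq, ← Fintype.sum_prod_type' (f := fun x y => pX x * pX y *
      (∑ F, pF F * (((F x : ℤ) : ℝ) * ((F y : ℤ) : ℝ))) ^ 2)]
    refine (sq_weighted_sum_le hw hw1 _).trans
      (sum_le_sum fun z _ => mul_le_mul_of_nonneg_left ?_ (hw z))
    rw [mul_pow, mul_pow]
    exact mul_le_of_le_one_left (sq_nonneg _)
      (mul_le_one₀ (hsq _) (sq_nonneg _) (hsq _))
  calc _ = ((∑ F, pF F * |∑ x, pX x * (h x * ((F x : ℤ) : ℝ))|) ^ 2) ^ 2 := by ring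
    _ ≤ V ^ 2 := pow_le_pow_left₀ (sq_nonneg _) h1 2
    _ ≤ _ := h2

/-- The transition weights of the trace of `A` when samples have weights `q`. -/
noncomputable def traceKernel {𝒵 𝒲 : Type*} [Fintype 𝒵] [DecidableEq 𝒲]
    (A : 𝒵 → List 𝒲 → 𝒲) (q : 𝒵 → ℝ) (l : List 𝒲) (a : 𝒲) : ℝ :=
  ∑ z, q z * (if A z l = a then 1 else 0)

theorem traceKernel_nonneg {𝒵 𝒲 : Type*} [Fintype 𝒵] [DecidableEq 𝒲]
    (A : 𝒵 → List 𝒲 → 𝒲) {q : 𝒵 → ℝ} (hq : ∀ z, 0 ≤ q z) (l : List 𝒲) (a : 𝒲) :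
    0 ≤ traceKernel A q l a :=
  sum_nonneg fun z _ => mul_nonneg (hq z) (by split_ifs <;> norm_num)

theorem sum_traceKernel {𝒵 𝒲 : Type*} [Fintype 𝒵] [Fintype 𝒲] [DecidableEq 𝒲]
    (A : 𝒵 → List 𝒲 → 𝒲) (q : 𝒵 → ℝ) (l : List 𝒲) :
    ∑ a, traceKernel A q l a = ∑ z, q z := by
  unfold traceKernel
  rw [sum_comm]
  simp

theorem sum_intUnits {M : Type*} [AddCommMonoid M] (f : ℤˣ → M) : ∑ s, f s = f 1 + f (-1) := by
  rw [show (univ : Finset ℤˣ) = {1, -1} from rfl, sum_pair (by decide)]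

theorem planted_sub_uniform {n : ℕ} (F : (Fin n → ℤˣ) → ℤˣ) (g : (Fin n → ℤˣ) × ℤˣ → ℝ) :
    ∑ z, (1 / 2 ^ (n + 1) : ℝ) * g z -
        ∑ z, ((1 / 2 ^ n : ℝ) * if z.2 = F z.1 then 1 else 0) * g z =
      ∑ x, (1 / 2 ^ n : ℝ) * ((g (x, -1) - g (x, 1)) / 2 * ((F x : ℤ) : ℝ)) := by
  rw [← sum_sub_distrib, Fintype.sum_prod_type]
  refine sum_congr rfl fun x _ => ?_
  rw [sum_intUnits]
  have h1 : (1 : ℤˣ) ≠ -1 := by decide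
  rcases Int.units_eq_one_or (F x) with h | h <;> simp [h, h1, h1.symm, pow_succ] <;> ring

/-- there is a universal constant `C > 0` such that for any sequential
learning algorithm `A` with record alphabet `𝒲`, any function distribution `pF` on
`{−1,1}^n → {−1,1}` with cross-predictability `cp` and `q = cp^{1/24}`, if `|𝒲| ≤ 1/q`
and `m < 1/q`, then the total variation between the law of the trace `(W_1,…,W_m)` under
the junk model `P_𝒵 = ⋆` (uniform samples on `{−1,1}^{n+1}`) and under the planted model
`P_𝒵 = ρ_F`, `F ∼ pF` (samples `(X, F(X))`, `X` uniform) is at most `C·q`. -/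
theorem sla_indistinguishability :
    ∃ C : ℝ, 0 < C ∧
      ∀ (n : ℕ), 1 ≤ n →
      ∀ (𝒲 : Type) [Fintype 𝒲] [DecidableEq 𝒲] [Nonempty 𝒲],
      ∀ (A : ((Fin n → ℤˣ) × ℤˣ) → List 𝒲 → 𝒲)
        (pF : ((Fin n → ℤˣ) → ℤˣ) → ℝ),
        (∀ F, 0 ≤ pF F) → (∑ F : (Fin n → ℤˣ) → ℤˣ, pF F = 1) →
      ∀ (m : ℕ), 1 ≤ m →
        (Fintype.card 𝒲 : ℝ)
            ≤ 1 / (cp (fun _ : Fin n → ℤˣ => (1 / 2 ^ n : ℝ)) pF) ^ ((1 : ℝ) / 24) →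
        (m : ℝ) < 1 / (cp (fun _ : Fin n → ℤˣ => (1 / 2 ^ n : ℝ)) pF) ^ ((1 : ℝ) / 24) →
        ∑ w : Fin m → 𝒲,
            |traceProb A (fun _ => (1 / 2 ^ (n + 1) : ℝ)) m w
              - ∑ F : (Fin n → ℤˣ) → ℤˣ, pF F *
                  traceProb A
                    (fun z => (1 / 2 ^ n : ℝ) * if z.2 = F z.1 then 1 else 0) m w|
          ≤ C * (cp (fun _ : Fin n → ℤˣ => (1 / 2 ^ n : ℝ)) pF) ^ ((1 : ℝ) / 24) := by
  refine ⟨1, one_pos, ?_⟩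
  intro n _ 𝒲 _ _ _ A pF hF hF1 m hm hcard hmq
  set c := cp (fun _ : Fin n → ℤˣ => (1 / 2 ^ n : ℝ)) pF with hc
  have hc0 : 0 ≤ c := cp_nonneg _ hF
  set q := c ^ ((1 : ℝ) / 24) with hq
  have hqc : q ^ 24 = c := by
    rw [hq, ← Real.rpow_natCast, ← Real.rpow_mul hc0]
    norm_num
  have hm1 : (1 : ℝ) ≤ m := by exact_mod_cast hm
  have hq0 : 0 < q := one_div_pos.1 (by linarith)
  have hmq' : m * q ≤ 1 := ((lt_div_iff₀ hq0).1 hmq).le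
  have hcardq : Fintype.card 𝒲 * q ≤ 1 := (le_div_iff₀ hq0).1 hcard
  have hq1 : q ≤ 1 := (le_mul_of_one_le_left hq0.le hm1).trans hmq'
  have hX1 : ∑ _x : Fin n → ℤˣ, (1 / 2 ^ n : ℝ) = 1 := by simp
  set ρ : ((Fin n → ℤˣ) → ℤˣ) → (Fin n → ℤˣ) × ℤˣ → ℝ :=
    fun F z => (1 / 2 ^ n : ℝ) * if z.2 = F z.1 then 1 else 0 with hρ
  have hρ0 (F z) : 0 ≤ ρ F z :=
    mul_nonneg (by positivity) (by split_ifs <;> norm_num)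
  have hρ1 (F) : ∑ z, ρ F z = 1 := by
    rw [Fintype.sum_prod_type, ← hX1]
    refine sum_congr rfl fun x _ => ?_
    simp only [hρ, ← mul_sum, sum_ite_eq', mem_univ, if_true, mul_one]
  have hu1 : ∑ _z : (Fin n → ℤˣ) × ℤˣ, (1 / 2 ^ (n + 1) : ℝ) = 1 := by
    simp [pow_succ]
    field_simp
  have hquery (l : List 𝒲) (a : 𝒲) : ∑ F, pF F *
      |traceKernel A (fun _ => (1 / 2 ^ (n + 1) : ℝ)) l a - traceKernel A (ρ F) l a| ≤ q ^ 6 := by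
    refine le_of_pow_le_pow_left₀ four_ne_zero (by positivity) ?_
    rw [← pow_mul, hqc]
    simp only [traceKernel, hρ, planted_sub_uniform _ fun z => if A z l = a then (1 : ℝ) else 0]
    refine sum_abs_correlation_pow_four_le (fun _ => by positivity) hX1 hF hF1 fun x => ?_
    split_ifs <;> norm_num [abs_le]
  have hδ (l : List 𝒲) : ∑ F, pF F * ∑ a,
      |traceKernel A (fun _ => (1 / 2 ^ (n + 1) : ℝ)) l a - traceKernel A (ρ F) l a| ≤
        Fintype.card 𝒲 * q ^ 6 := by
    simp_rw [mul_sum]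
    rw [sum_comm]
    refine (sum_le_sum fun a _ => hquery l a).trans_eq ?_
    simp
  have hybrid := sum_abs_seqProb_sub_le hF
    (traceKernel_nonneg A fun _ => by positivity)
    (fun l => (sum_traceKernel A _ l).trans hu1)
    (fun F => traceKernel_nonneg A (hρ0 F))
    (fun F l => (sum_traceKernel A _ l).trans (hρ1 F)) hδ m
  calc _ ≤ ∑ w : Fin m → 𝒲, ∑ F, pF F *
        |traceProb A (fun _ => (1 / 2 ^ (n + 1) : ℝ)) m w - traceProb A (ρ F) m w| := by
        refine sum_le_sum fun w _ => ?_
        set u := traceProb A (fun _ => (1 / 2 ^ (n + 1) : ℝ)) m w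
        have hu : u = ∑ F, pF F * u := by rw [← sum_mul, hF1, one_mul]
        conv_lhs => rw [hu, ← sum_sub_distrib]
        refine (abs_sum_le_sum_abs _ _).trans_eq (sum_congr rfl fun F _ => ?_)
        rw [← mul_sub, abs_mul, abs_of_nonneg (hF F)]
    _ = ∑ F, pF F * ∑ w : Fin m → 𝒲,
        |traceProb A (fun _ => (1 / 2 ^ (n + 1) : ℝ)) m w - traceProb A (ρ F) m w| := by
        rw [sum_comm]
        simp_rw [mul_sum]
    _ ≤ m * (Fintype.card 𝒲 * q ^ 6) := hybrid
    _ = (m * q) * (Fintype.card 𝒲 * q) * q ^ 4 := by ring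
    _ ≤ 1 * 1 * q ^ 4 := by gcongr
    _ ≤ 1 * q := by
        rw [one_mul, one_mul, one_mul]
        exact pow_le_of_le_one hq0.le hq1 four_ne_zero
end

section
/- Let m be a positive integer, σ > 0, and r > m·√(2σ/π). Then (2πσ)^{−m/2} · ∫_{{x ∈ ℝ^m : ‖x‖₁ ≥ r}} e^{−‖x‖₂²/(2σ)} dx ≤ e^{−(r/(2√σ) − m/√(2π))²/m}, where ‖x‖₁ = ∑_{i=1}^m |x_i| and ‖x‖₂ is the Euclidean norm. -/
open MeasureTheory Finset

theorem integrable_exp_mul_abs_sub_sq_div {σ : ℝ} (hσ : 0 < σ) (s : ℝ) :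
    Integrable fun x : ℝ => Real.exp (s * |x| - x ^ 2 / (2 * σ)) := by
  have hb : 0 < 1 / (4 * σ) := by positivity
  refine ((integrable_exp_neg_mul_sq hb).const_mul (Real.exp (s ^ 2 * σ))).mono'
    (by fun_prop) (Filter.Eventually.of_forall fun x => ?_)
  rw [Real.norm_eq_abs, Real.abs_exp, ← Real.exp_add, Real.exp_le_exp]
  have h : s ^ 2 * σ + -(1 / (4 * σ)) * x ^ 2 - (s * |x| - x ^ 2 / (2 * σ))
      = (2 * σ * s - |x|) ^ 2 / (4 * σ) := by
    rw [← sq_abs x]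
    field_simp
    ring
  have : 0 ≤ (2 * σ * s - |x|) ^ 2 / (4 * σ) := by positivity
  linarith

/-- The exponential moment of the absolute value of a centered Gaussian variable, up to
normalization. -/
theorem integral_exp_mul_abs_sub_sq_div_le {σ s : ℝ} (hσ : 0 < σ) (hs : 0 ≤ s) :
    ∫ x : ℝ, Real.exp (s * |x| - x ^ 2 / (2 * σ)) ≤
      Real.sqrt (2 * Real.pi * σ) *
        Real.exp (s ^ 2 * σ / 2 + s * Real.sqrt (2 * σ / Real.pi)) := by
  have hb : 0 < 1 / (2 * σ) := by positivity
  set g : ℝ → ℝ := fun x => Real.exp (-(1 / (2 * σ)) * x ^ 2) with hg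
  have hgi : Integrable g := integrable_exp_neg_mul_sq hb
  have hneg : -(s * σ) ≤ 0 := by nlinarith
  have habs : ∫ x : ℝ, Real.exp (s * |x| - x ^ 2 / (2 * σ)) =
      2 * ∫ x in Set.Ioi (0 : ℝ), Real.exp (s * x - x ^ 2 / (2 * σ)) := by
    rw [← integral_comp_abs (f := fun x => Real.exp (s * x - x ^ 2 / (2 * σ)))]
    simp only [sq_abs]
  have hshift : ∫ x in Set.Ioi (0 : ℝ), Real.exp (s * x - x ^ 2 / (2 * σ)) =
      Real.exp (s ^ 2 * σ / 2) * ∫ x in Set.Ioi (-(s * σ)), g x := by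
    have h := (measurePreserving_add_right volume (-(s * σ))).setIntegral_preimage_emb
      (measurableEmbedding_addRight _) g (Set.Ioi (-(s * σ)))
    rw [Set.preimage_add_const_Ioi, sub_self] at h
    rw [← h, ← integral_const_mul]
    congr 1 with x
    rw [hg, ← Real.exp_add]
    congr 1
    field_simp
    ring
  have hsplit : ∫ x in Set.Ioi (-(s * σ)), g x =
      (∫ x in Set.Ioc (-(s * σ)) 0, g x) + ∫ x in Set.Ioi (0 : ℝ), g x := by
    rw [← Set.Ioc_union_Ioi_eq_Ioi hneg]
    exact setIntegral_union (Set.Ioc_disjoint_Ioi le_rfl) measurableSet_Ioi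
      hgi.integrableOn hgi.integrableOn
  have hnear : ∫ x in Set.Ioc (-(s * σ)) 0, g x ≤ s * σ := by
    calc ∫ x in Set.Ioc (-(s * σ)) 0, g x ≤ ∫ _ in Set.Ioc (-(s * σ)) 0, (1 : ℝ) := by
          refine setIntegral_mono hgi.integrableOn (by simp) fun x => ?_
          exact Real.exp_le_one_iff.2 (by nlinarith [sq_nonneg x])
      _ = s * σ := by
          simp [Measure.real, mul_nonneg hs hσ.le]
  have hhalf : ∫ x in Set.Ioi (0 : ℝ), g x = Real.sqrt (2 * Real.pi * σ) / 2 := by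
    rw [hg, integral_gaussian_Ioi]
    congr 2
    field_simp
  have hsqrt : 2 * σ = Real.sqrt (2 * Real.pi * σ) * Real.sqrt (2 * σ / Real.pi) := by
    rw [← Real.sqrt_mul (by positivity)]
    rw [show 2 * Real.pi * σ * (2 * σ / Real.pi) = (2 * σ) ^ 2 by field_simp]
    exact (Real.sqrt_sq (by positivity)).symm
  have hexp := Real.add_one_le_exp (s * Real.sqrt (2 * σ / Real.pi))
  rw [habs, hshift, hsplit, hhalf, Real.exp_add]
  calc 2 * (Real.exp (s ^ 2 * σ / 2) *
        ((∫ x in Set.Ioc (-(s * σ)) 0, g x) + Real.sqrt (2 * Real.pi * σ) / 2))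
      ≤ 2 * (Real.exp (s ^ 2 * σ / 2) * (s * σ + Real.sqrt (2 * Real.pi * σ) / 2)) := by gcongr
    _ = Real.sqrt (2 * Real.pi * σ) * (Real.exp (s ^ 2 * σ / 2) *
        (s * Real.sqrt (2 * σ / Real.pi) + 1)) := by
      linear_combination Real.exp (s ^ 2 * σ / 2) * s * hsqrt
    _ ≤ _ := by gcongr

/-- Gaussian ℓ¹-tail bound. For `m ≥ 1`, `σ > 0` and `r > m√(2σ/π)`,
`(2πσ)^{−m/2} ∫_{‖x‖₁ ≥ r} e^{−‖x‖₂²/(2σ)} dx ≤ exp(−(r/(2√σ) − m/√(2π))²/m)`. -/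
theorem gaussian_l1_tail_bound (m : ℕ) (hm : 1 ≤ m) (σ r : ℝ) (hσ : 0 < σ)
    (hr : (m : ℝ) * Real.sqrt (2 * σ / Real.pi) < r) :
    (2 * Real.pi * σ) ^ (-(m : ℝ) / 2) *
        ∫ x in {x : Fin m → ℝ | r ≤ ∑ i, |x i|}, Real.exp (-(∑ i, x i ^ 2) / (2 * σ))
      ≤ Real.exp (-(r / (2 * Real.sqrt σ) - m / Real.sqrt (2 * Real.pi)) ^ 2 / m) := by
  have hm0 : (0 : ℝ) < m := by exact_mod_cast hm
  set D := r - m * Real.sqrt (2 * σ / Real.pi) with hD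
  have hDpos : 0 < D := sub_pos.2 hr
  set s := D / (m * σ) with hs
  have hspos : 0 < s := by positivity
  set f : ℝ → ℝ := fun x => Real.exp (s * |x| - x ^ 2 / (2 * σ)) with hf
  have hfi : Integrable f := integrable_exp_mul_abs_sub_sq_div hσ s
  have hFi : Integrable fun x : Fin m → ℝ => Real.exp (-(s * r)) * ∏ i, f (x i) :=
    (Integrable.fintype_prod fun _ => hfi).const_mul _
  have hprod (x : Fin m → ℝ) : ∏ i, f (x i) =
      Real.exp (s * ∑ i, |x i|) * Real.exp (-(∑ i, x i ^ 2) / (2 * σ)) := by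
    rw [hf, ← Real.exp_sum, ← Real.exp_add, sum_sub_distrib, mul_sum, ← sum_div, neg_div,
      sub_eq_add_neg]
  have hmeas : MeasurableSet {x : Fin m → ℝ | r ≤ ∑ i, |x i|} :=
    measurableSet_le measurable_const (by fun_prop)
  have hchernoff : ∫ x in {x : Fin m → ℝ | r ≤ ∑ i, |x i|},
      Real.exp (-(∑ i, x i ^ 2) / (2 * σ)) ≤ Real.exp (-(s * r)) * (∫ x, f x) ^ m := by
    calc _ ≤ ∫ x in {x : Fin m → ℝ | r ≤ ∑ i, |x i|},
          Real.exp (-(s * r)) * ∏ i, f (x i) := by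
          refine integral_mono_of_nonneg (Filter.Eventually.of_forall fun x => (Real.exp_pos _).le)
            hFi.integrableOn ((ae_restrict_iff' hmeas).2 (Filter.Eventually.of_forall fun x hx => ?_))
          beta_reduce
          rw [hprod, ← mul_assoc, ← Real.exp_add]
          refine le_mul_of_one_le_left (Real.exp_pos _).le (Real.one_le_exp ?_)
          have : s * r ≤ s * ∑ i, |x i| := mul_le_mul_of_nonneg_left hx hspos.le
          linarith
      _ ≤ ∫ x : Fin m → ℝ, Real.exp (-(s * r)) * ∏ i, f (x i) :=
          setIntegral_le_integral hFi (Filter.Eventually.of_forall fun x =>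
            mul_nonneg (Real.exp_pos _).le (prod_nonneg fun i _ => (Real.exp_pos _).le))
      _ = _ := by
          rw [integral_const_mul, integral_fintype_prod_volume_eq_pow, Fintype.card_fin]
  have hmoment : (∫ x, f x) ^ m ≤ Real.sqrt (2 * Real.pi * σ) ^ m *
      Real.exp (m * (s ^ 2 * σ / 2 + s * Real.sqrt (2 * σ / Real.pi))) := by
    rw [Real.exp_nat_mul, ← mul_pow]
    exact pow_le_pow_left₀ (integral_nonneg fun x => (Real.exp_pos _).le)
      (integral_exp_mul_abs_sub_sq_div_le hσ hspos.le) m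
  have hnorm : (2 * Real.pi * σ) ^ (-(m : ℝ) / 2) * Real.sqrt (2 * Real.pi * σ) ^ m = 1 := by
    have h0 : 0 < 2 * Real.pi * σ := by positivity
    rw [Real.sqrt_eq_rpow, ← Real.rpow_natCast, ← Real.rpow_mul h0.le, ← Real.rpow_add h0]
    rw [show -(m : ℝ) / 2 + 1 / 2 * m = 0 by ring, Real.rpow_zero]
  have hexponent : -(s * r) + m * (s ^ 2 * σ / 2 + s * Real.sqrt (2 * σ / Real.pi)) =
      -(D ^ 2 / (2 * m * σ)) := by
    rw [show r = D + m * Real.sqrt (2 * σ / Real.pi) by rw [hD]; ring, hs]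
    field_simp
    ring
  have hroot : r / (2 * Real.sqrt σ) - m / Real.sqrt (2 * Real.pi) = D / (2 * Real.sqrt σ) := by
    have h2 : Real.sqrt (2 * σ / Real.pi) = 2 * Real.sqrt σ / Real.sqrt (2 * Real.pi) := by
      rw [eq_div_iff (by positivity), ← Real.sqrt_mul (by positivity),
        show 2 * σ / Real.pi * (2 * Real.pi) = 2 ^ 2 * σ by field_simp,
        Real.sqrt_mul (by positivity), Real.sqrt_sq (by norm_num)]
    rw [hD, h2]
    field_simp
  calc _ ≤ (2 * Real.pi * σ) ^ (-(m : ℝ) / 2) * (Real.exp (-(s * r)) *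
        (Real.sqrt (2 * Real.pi * σ) ^ m *
          Real.exp (m * (s ^ 2 * σ / 2 + s * Real.sqrt (2 * σ / Real.pi))))) := by
        gcongr
        exact hchernoff.trans (by gcongr)
    _ = Real.exp (-(D ^ 2 / (2 * m * σ))) := by
        rw [← hexponent, Real.exp_add]
        linear_combination Real.exp (-(s * r)) *
          Real.exp (m * (s ^ 2 * σ / 2 + s * Real.sqrt (2 * σ / Real.pi))) * hnorm
    _ ≤ _ := by
        rw [Real.exp_le_exp, hroot, div_pow, mul_pow, Real.sq_sqrt hσ.le, neg_div, neg_le_neg_iff,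
          div_div]
        refine div_le_div_of_nonneg_left (by positivity) (by positivity) ?_
        nlinarith [mul_pos hm0 hσ]
end
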